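/- arXiv:1711.01805 — 2 statements merged into one kernel-verified Lean document; each statement's English description precedes it below -/
import Mathlib

section
/- For every λ ∈ (−1, 1) and every α ∈ ℂ, the operator B(λ, α) on ℓ²(ℤ,ℂ) ⊕ ℓ²(ℤ,ℂ) is homogeneous: its spectrum is contained in the closed unit disc, and for every θ ∈ ℝ and every c ∈ ℂ with |c| < 1, the operator 1 − conj(c)·B(λ, α) is invertible and e^{iθ}(B(λ, α) − c·1)(1 − conj(c)·B(λ, α))⁻¹ is unitarily equivalent to B(λ, α). -/
noncomputable section

open ContinuousLinearMap

/-- The Hilbert space `ℓ²(ℤ, ℂ)`. -/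
abbrev H : Type := lp (fun _ : ℤ => ℂ) 2

/-- The standard orthonormal basis vectors of `ℓ²(ℤ, ℂ)`. -/
def e (n : ℤ) : H := lp.single 2 n 1

/-- The `2 × 2` upper-triangular block operator `[[T₁, S], [0, T₂]]` on the Hilbert space
direct sum `E ⊕ E = WithLp 2 (E × E)`. -/
def blockOp {E : Type*} [NormedAddCommGroup E] [NormedSpace ℂ E]
    (T₁ S T₂ : E →L[ℂ] E) : WithLp 2 (E × E) →L[ℂ] WithLp 2 (E × E) :=
  ((WithLp.prodContinuousLinearEquiv 2 ℂ E E).symm :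
      E × E →L[ℂ] WithLp 2 (E × E)) ∘L
    ((((T₁ ∘L fst ℂ E E) + (S ∘L snd ℂ E E)).prod (T₂ ∘L snd ℂ E E)) ∘L
      ((WithLp.prodContinuousLinearEquiv 2 ℂ E E) :
        WithLp 2 (E × E) →L[ℂ] E × E))

/-- Unitary equivalence of bounded operators on (possibly different) complex Hilbert spaces:
there is a unitary (= surjective linear isometry) `U` with `U A U⁻¹ = B`. -/
def UnitarilyEquiv {E F : Type*} [NormedAddCommGroup E] [NormedSpace ℂ E]
    [NormedAddCommGroup F] [NormedSpace ℂ F] (A : E →L[ℂ] E) (B : F →L[ℂ] F) : Prop :=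
  ∃ U : E ≃ₗᵢ[ℂ] F, ∀ x, U (A x) = B (U x)

/-- The Möbius transform `e^{iθ} (T - c·1)(1 - c̄·T)⁻¹` of an operator. -/
def mobius {E : Type*} [NormedAddCommGroup E] [NormedSpace ℂ E] [CompleteSpace E]
    (θ : ℝ) (c : ℂ) (T : E →L[ℂ] E) : E →L[ℂ] E :=
  Complex.exp (θ * Complex.I) •
    ((T - c • (1 : E →L[ℂ] E)) * Ring.inverse (1 - (starRingEnd ℂ c) • T))

/-- A bounded operator on a complex Hilbert space is homogeneous if its spectrum lies in the
closed unit disc and all its Möbius transforms are unitarily equivalent to it. -/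
def Homogeneous {E : Type*} [NormedAddCommGroup E] [NormedSpace ℂ E] [CompleteSpace E]
    (T : E →L[ℂ] E) : Prop :=
  spectrum ℂ T ⊆ Metric.closedBall 0 1 ∧
    ∀ (θ : ℝ) (c : ℂ), ‖c‖ < 1 →
      IsUnit (1 - (starRingEnd ℂ c) • T) ∧ UnitarilyEquiv (mobius θ c T) T

/-- A bounded operator is irreducible if the only closed subspaces invariant under both the
operator and its adjoint are `{0}` and the whole space. -/
def IrreducibleOp {E : Type*} [NormedAddCommGroup E] [InnerProductSpace ℂ E] [CompleteSpace E]
    (T : E →L[ℂ] E) : Prop :=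
  ∀ M : Submodule ℂ E, IsClosed (M : Set E) → (∀ x ∈ M, T x ∈ M) →
    (∀ x ∈ M, ContinuousLinearMap.adjoint T x ∈ M) → M = ⊥ ∨ M = ⊤

/-- Weight sequence of the shift `B_{λ, ia}`. -/
def wB (l a : ℝ) (n : ℤ) : ℂ :=
  ((n : ℂ) + (1 + (l : ℂ)) / 2 + Complex.I * (a : ℂ)) /
    ((n : ℂ) + (1 + (l : ℂ)) / 2 - Complex.I * (a : ℂ))

/-- Weight sequence of the shift `T(a, b)`. -/
def wT (a b : ℝ) (n : ℤ) : ℂ := (Real.sqrt (((n : ℝ) + a) / ((n : ℝ) + b)) : ℂ)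

/-- Weight sequence of the shift `S[λ]`. -/
def wS (l : ℝ) (n : ℤ) : ℂ := ((l : ℂ) + 2 * (n : ℂ) + 1)⁻¹

theorem Ring.inverse_eq_of_mul_eq_one {R : Type*} [Ring R] {a b : R} (h : b * a = 1)
    (h' : a * b = 1) : Ring.inverse a = b :=
  Ring.inverse_unit ⟨a, b, h', h⟩

section InnerDerivation

variable {C A : Type*} [CommCStarAlgebra C] [CStarAlgebra A]

/-- `ρ a` has formal derivative `ρ a'` with respect to the (possibly unbounded) operator `D⁻¹ / 2`:
this is the relation `[D⁻¹, ρ a] = 2 ρ a'`, multiplied by `D` on both sides. -/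
def HasFormalDeriv (ρ : C →⋆ₐ[ℂ] A) (D : A) (a a' : C) : Prop :=
  ρ a * D - D * ρ a = (2 : ℂ) • (D * ρ a' * D)

namespace HasFormalDeriv

variable {ρ : C →⋆ₐ[ℂ] A} {D : A} {a a' b b' : C}

theorem one : HasFormalDeriv ρ D 1 0 := by
  simp [HasFormalDeriv]

theorem add (ha : HasFormalDeriv ρ D a a') (hb : HasFormalDeriv ρ D b b') :
    HasFormalDeriv ρ D (a + b) (a' + b') := by
  unfold HasFormalDeriv at *
  simp only [map_add, mul_add, add_mul, smul_add, ← ha, ← hb]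
  abel

theorem smul (t : ℂ) (ha : HasFormalDeriv ρ D a a') : HasFormalDeriv ρ D (t • a) (t • a') := by
  unfold HasFormalDeriv at *
  simp only [map_smul, smul_mul_assoc, mul_smul_comm]
  rw [smul_comm, ← ha, smul_sub]

theorem mul (ha : HasFormalDeriv ρ D a a') (hb : HasFormalDeriv ρ D b b') :
    HasFormalDeriv ρ D (a * b) (a' * b + a * b') := by
  unfold HasFormalDeriv at *
  have h1 : ρ a * D = D * ρ a + (2 : ℂ) • (D * ρ a' * D) := by rw [← ha]; abel
  have h2 : ρ b * D = D * ρ b + (2 : ℂ) • (D * ρ b' * D) := by rw [← hb]; abel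
  have h3 : ρ a * ρ b * D = D * ρ a * ρ b + (2 : ℂ) • (D * ρ a' * (ρ b * D))
      + (2 : ℂ) • (D * ρ a * ρ b' * D) := by
    calc ρ a * ρ b * D = ρ a * (ρ b * D) := mul_assoc _ _ _
      _ = ρ a * D * ρ b + (2 : ℂ) • (ρ a * D * ρ b' * D) := by
        rw [h2, mul_add, mul_smul_comm]; simp only [mul_assoc]
      _ = _ := by
        rw [h1, h2]
        simp only [add_mul, mul_add, smul_mul_assoc, mul_smul_comm, smul_add, mul_assoc]
        abel
  rw [map_mul, h3]
  simp only [map_add, map_mul, mul_add, add_mul, smul_add, mul_assoc]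
  abel

theorem pow {s : ℂ} (ha : HasFormalDeriv ρ D a (s • a)) (n : ℕ) :
    HasFormalDeriv ρ D (a ^ n) ((n * s : ℂ) • a ^ n) := by
  induction n with
  | zero => simpa using one
  | succ n ih =>
    rw [pow_succ]
    convert! ih.mul ha using 1
    simp only [smul_mul_assoc, mul_smul_comm, ← add_smul]
    congr 1
    push_cast
    ring

theorem pow_add_one (ha : HasFormalDeriv ρ D a a') (n : ℕ) :
    HasFormalDeriv ρ D (a ^ (n + 1)) ((n + 1 : ℂ) • (a' * a ^ n)) := by
  induction n with
  | zero => simpa using ha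
  | succ n ih =>
    rw [pow_succ]
    convert! ih.mul ha using 1
    rw [smul_mul_assoc, mul_assoc, ← pow_succ, mul_comm _ a']
    push_cast
    module

theorem of_hasSum {f f' : ℕ → C} (h : ∀ n, HasFormalDeriv ρ D (f n) (f' n))
    (ha : HasSum f a) (ha' : HasSum f' a') : HasFormalDeriv ρ D a a' := by
  have hρ : Continuous ρ :=
    AddMonoidHomClass.continuous_of_bound ρ 1 (by simpa using NonUnitalStarAlgHom.norm_apply_le ρ)
  have h1 : HasSum (fun n => ρ (f n)) (ρ a) := ha.map ρ hρ
  have h2 : HasSum (fun n => ρ (f' n)) (ρ a') := ha'.map ρ hρ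
  refine ((h1.mul_right D).sub (h1.mul_left D)).unique ?_
  convert! ((h2.mul_left D).mul_right D).const_smul (2 : ℂ) using 1
  exact funext h

theorem exp (ha : HasFormalDeriv ρ D a a') :
    HasFormalDeriv ρ D (NormedSpace.exp a) (a' * NormedSpace.exp a) := by
  have h : HasSum (fun n : ℕ => ((n.factorial : ℂ)⁻¹) • a ^ n) (NormedSpace.exp a) :=
    NormedSpace.exp_series_hasSum_exp' (𝕂 := ℂ) a
  refine of_hasSum (f' := fun n => Nat.casesOn n 0
    fun n => a' * (((n.factorial : ℂ)⁻¹) • a ^ n)) (fun n => ?_) h ?_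
  · cases n with
    | zero => simpa using one
    | succ n =>
      convert! (ha.pow_add_one n).smul (((n + 1).factorial : ℂ)⁻¹) using 1
      simp only [mul_smul_comm, smul_smul]
      congr 1
      have : ((n : ℂ) + 1) ≠ 0 := Nat.cast_add_one_ne_zero n
      rw [Nat.factorial_succ]
      push_cast
      field_simp
  · rw [← hasSum_nat_add_iff' 1]
    simpa using h.mul_left a'

/-- `∑ xᵏ / k`, a logarithm of the resolvent `q = (1 - x)⁻¹`, has derivative `s x q`. -/
theorem exists_log {x q : C} {s : ℂ} (hx : ‖x‖ < 1) (hq : q * (1 - x) = 1)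
    (hd : HasFormalDeriv ρ D x (s • x)) : ∃ y, HasFormalDeriv ρ D y (s • (x * q)) := by
  have hinv : Ring.inverse (1 - x) = q := Ring.inverse_eq_of_mul_eq_one hq (mul_comm _ q ▸ hq)
  have hg : HasSum (fun n => x ^ n) q := hinv ▸ hasSum_geom_series_inverse x hx
  have hg' : HasSum (fun n => s • x ^ (n + 1)) (s • (x * q)) := by
    simpa only [pow_succ'] using (hg.mul_left x).const_smul s
  have hsum : Summable fun n : ℕ => ((n + 1 : ℂ)⁻¹) • x ^ (n + 1) := by
    refine Summable.of_norm_bounded (g := fun n => ‖x‖ ^ n)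
      (summable_geometric_of_lt_one (norm_nonneg _) hx) fun n => ?_
    rw [norm_smul]
    have h1 : ‖(n + 1 : ℂ)⁻¹‖ ≤ 1 := by
      rw [norm_inv]
      apply inv_le_one_of_one_le₀
      have : ‖(n + 1 : ℂ)‖ = n + 1 := by exact_mod_cast Complex.norm_natCast (n + 1)
      rw [this]
      linarith [(Nat.cast_nonneg n : (0 : ℝ) ≤ n)]
    have h2 : ‖x ^ (n + 1)‖ ≤ ‖x‖ ^ n := by
      refine (norm_pow_le' x n.succ_pos).trans ?_
      exact pow_le_pow_of_le_one (norm_nonneg _) hx.le n.le_succ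
    nlinarith [norm_nonneg (x ^ (n + 1)), norm_nonneg (n + 1 : ℂ)⁻¹]
  refine ⟨_, of_hasSum (fun n => ?_) hsum.hasSum hg'⟩
  convert! (hd.pow (n + 1)).smul ((n + 1 : ℂ)⁻¹) using 1
  have : ((n : ℂ) + 1) ≠ 0 := Nat.cast_add_one_ne_zero n
  rw [smul_smul]
  congr 1
  push_cast
  field_simp

theorem resolvent {x q : C} (hx : ‖x‖ < 1) (hq : q * (1 - x) = 1)
    (hd : HasFormalDeriv ρ D x x) : HasFormalDeriv ρ D q (x * q ^ 2) := by
  have hinv : Ring.inverse (1 - x) = q := Ring.inverse_eq_of_mul_eq_one hq (mul_comm _ q ▸ hq)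
  have hg : HasSum (fun n => x ^ n) q := hinv ▸ hasSum_geom_series_inverse x hx
  have hg' : HasSum (fun n : ℕ => (n : C) * x ^ n) (x * q ^ 2) := by
    rw [← hinv]; exact hasSum_coe_mul_geometric_of_norm_lt_one' hx
  refine of_hasSum (fun n => ?_) hg hg'
  have hd' : HasFormalDeriv ρ D x ((1 : ℂ) • x) := by simpa using hd
  convert! hd'.pow n using 1
  simp [Algebra.smul_def]

variable {u v q qs : C} {c : ℂ}

theorem moebius (hu1 : ‖u‖ ≤ 1) (hu : HasFormalDeriv ρ D u u) (hc : ‖c‖ < 1)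
    (hq : q * (1 - starRingEnd ℂ c • u) = 1) :
    HasFormalDeriv ρ D ((u - c • 1) * q) ((1 - c * starRingEnd ℂ c) • (u * q ^ 2)) := by
  have hx : ‖starRingEnd ℂ c • u‖ < 1 := by
    rw [norm_smul, RCLike.norm_conj]
    nlinarith [norm_nonneg c, norm_nonneg u]
  have hd := ((hu.add (one.smul (-c))).mul (resolvent hx hq (hu.smul _)))
  convert! hd using 1
  · rw [neg_smul, sub_eq_add_neg]
  · simp only [Algebra.smul_def, map_sub, map_mul, map_one, map_neg] at hq ⊢
    linear_combination (u * q) * hq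

theorem exists_eigenfunction (hu1 : ‖u‖ ≤ 1) (hv1 : ‖v‖ ≤ 1) (huv : u * v = 1)
    (hu : HasFormalDeriv ρ D u u) (hv : HasFormalDeriv ρ D v (-v)) (hc : ‖c‖ < 1)
    (hq : q * (1 - starRingEnd ℂ c • u) = 1) (hqs : qs * (1 - c • v) = 1) (p : ℂ) :
    ∃ E : C, IsUnit E ∧ HasFormalDeriv ρ D ((1 - c • v) * E)
      (p • (((1 - c * starRingEnd ℂ c) • q - (1 - c • v)) * E)) := by
  have hx : ‖starRingEnd ℂ c • u‖ < 1 := by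
    rw [norm_smul, RCLike.norm_conj]
    nlinarith [norm_nonneg c, norm_nonneg u]
  have hy : ‖c • v‖ < 1 := by
    rw [norm_smul]
    nlinarith [norm_nonneg c, norm_nonneg v]
  obtain ⟨y₁, h₁⟩ := exists_log (s := 1) hx hq (by simpa using hu.smul (starRingEnd ℂ c))
  obtain ⟨y₂, h₂⟩ := exists_log (s := -1) hy hqs (by simpa using hv.smul c)
  refine ⟨_, NormedSpace.isUnit_exp_of_mem_ball (𝕂 := ℂ) (x := p • y₁ + (1 - p) • y₂)
    ((NormedSpace.expSeries_radius_eq_top ℂ C).symm ▸ edist_lt_top _ _), ?_⟩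
  have hd := (one.add (hv.smul (-c))).mul (((h₁.smul p).add (h₂.smul (1 - p))).exp)
  convert! hd using 1
  · rw [neg_smul, sub_eq_add_neg]
  · generalize NormedSpace.exp (p • y₁ + (1 - p) • y₂) = E
    simp only [Algebra.smul_def, map_sub, map_mul, map_one, map_neg] at hq hqs ⊢
    linear_combination (algebraMap ℂ C p * E) * hq
      + (1 - algebraMap ℂ C p) * E * algebraMap ℂ C c * v * hqs
      + algebraMap ℂ C p * E * q * algebraMap ℂ C c * algebraMap ℂ C (starRingEnd ℂ c) * huv

end HasFormalDeriv
end InnerDerivation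

open scoped InnerProductSpace

theorem apply_eq_inv_smul {E : Type*} [NormedAddCommGroup E] [NormedSpace ℂ E] {T W : E →L[ℂ] E}
    {d κ : ℂ} (h : W * T - T * W = d • (T * W * T)) (hκ : κ ≠ 0) (hκd : κ + d ≠ 0) {x : E}
    (hx : T x = κ⁻¹ • x) : T (W x) = (κ + d)⁻¹ • W x := by
  have h1 := congr($h x)
  simp only [_root_.sub_apply, mul_apply_eq_comp,
    _root_.smul_apply, hx, map_smul] at h1
  rw [eq_inv_smul_iff₀ hκd]
  have h2 : W x = κ • κ⁻¹ • W x := by rw [smul_inv_smul₀ hκ]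
  rw [sub_eq_iff_eq_add] at h1
  conv_rhs => rw [h2, h1]
  simp only [smul_add, smul_smul, add_smul]
  rw [mul_left_comm κ d, mul_inv_cancel₀ hκ, mul_one, add_comm]

theorem inner_e_left (n : ℤ) (x : H) : ⟪e n, x⟫_ℂ = x n := by
  simp [e, lp.inner_single_left]

theorem inner_e_e (m n : ℤ) : ⟪e m, e n⟫_ℂ = if m = n then 1 else 0 := by
  rw [inner_e_left, e, lp.single_apply]
  simp [Pi.single_apply]

theorem ext_inner_e {x y : H} (h : ∀ n, ⟪e n, x⟫_ℂ = ⟪e n, y⟫_ℂ) : x = y := by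
  ext n
  simpa only [inner_e_left] using h n

theorem clm_ext_e {F : Type*} [NormedAddCommGroup F] [NormedSpace ℂ F] {S T : H →L[ℂ] F}
    (h : ∀ n, S (e n) = T (e n)) : S = T := by
  refine lp.ext_continuousLinearMap (by simp) fun n => ?_
  ext
  simpa [e] using! h n

theorem adjoint_e {B₀ : H →L[ℂ] H} (hB₀ : ∀ n : ℤ, B₀ (e n) = e (n + 1)) (n : ℤ) :
    star B₀ (e n) = e (n - 1) := by
  refine ext_inner_e fun m => ?_
  rw [star_eq_adjoint, adjoint_inner_right, hB₀, inner_e_e, inner_e_e]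
  simp [eq_sub_iff_add_eq]

theorem mem_unitary_of_shift {B₀ : H →L[ℂ] H} (hB₀ : ∀ n : ℤ, B₀ (e n) = e (n + 1)) :
    B₀ ∈ unitary (H →L[ℂ] H) := by
  rw [Unitary.mem_iff]
  constructor <;> refine clm_ext_e fun n => ?_ <;> simp [hB₀, adjoint_e hB₀]

theorem star_mul_weightedShift_e {l : ℝ} {B₀ Sl : H →L[ℂ] H}
    (hB₀ : ∀ n : ℤ, B₀ (e n) = e (n + 1)) (hSl : ∀ n : ℤ, Sl (e n) = wS l n • e (n + 1))
    (n : ℤ) : (star B₀ * Sl) (e n) = wS l n • e n := by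
  simp [hSl, adjoint_e hB₀]

theorem add_two_mul_ne_zero {l : ℝ} (hl : -1 < l ∧ l < 1) (n : ℤ) :
    (l : ℂ) + 2 * n + 1 ≠ 0 := by
  intro h
  have h' : l + 2 * n + 1 = 0 := by exact_mod_cast h
  have h1 : (-1 : ℝ) < n := by linarith [hl.2]
  have h2 : (n : ℝ) < 0 := by linarith [hl.1]
  have h3 : -1 < n := by exact_mod_cast h1
  have h4 : n < 0 := by exact_mod_cast h2
  omega

theorem isSelfAdjoint_of_diagonal {l : ℝ} {D : H →L[ℂ] H} (hD : ∀ n, D (e n) = wS l n • e n) :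
    IsSelfAdjoint D := by
  refine clm_ext_e fun n => ext_inner_e fun m => ?_
  rw [star_eq_adjoint, adjoint_inner_right, hD, hD, inner_smul_left, inner_smul_right, inner_e_e]
  split_ifs with h
  · subst h
    simp [wS, Complex.conj_ofNat]
  · simp

theorem shift_commutator_diagonal {l : ℝ} (hl : -1 < l ∧ l < 1) {B₀ D : H →L[ℂ] H}
    (hB₀ : ∀ n : ℤ, B₀ (e n) = e (n + 1)) (hD : ∀ n, D (e n) = wS l n • e n) :
    B₀ * D - D * B₀ = (2 : ℂ) • (D * B₀ * D) := by
  refine clm_ext_e fun n => ?_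
  have h1 := add_two_mul_ne_zero hl n
  have h2 := add_two_mul_ne_zero hl (n + 1)
  simp only [_root_.sub_apply, mul_apply_eq_comp,
    _root_.smul_apply, hB₀, hD, map_smul, smul_smul, ← sub_smul]
  congr 1
  simp only [wS] at *
  field_simp
  push_cast
  ring

theorem shift_star_commutator {B D : H →L[ℂ] H} (hD : IsSelfAdjoint D)
    (h : B * D - D * B = (2 : ℂ) • (D * B * D)) :
    star B * D - D * star B = (-2 : ℂ) • (D * star B * D) := by
  have h' := congr(star $h)
  simp only [star_sub, star_mul, star_smul, hD.star_eq] at h'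
  rw [← neg_sub, h', neg_smul, mul_assoc]
  simp

/-- A unitary operator `b` and a self-adjoint `T` which satisfy the relations of the bilateral shift
and of the diagonal operator with entries `1 / (l + 2 * n + 1)`, the latter having an eigenvector
cyclic for `b`, are simultaneously unitarily equivalent to them. -/
theorem exists_intertwiner {l : ℝ} (hl : -1 < l ∧ l < 1) {B₀ D : H →L[ℂ] H}
    (hB₀ : ∀ n : ℤ, B₀ (e n) = e (n + 1)) (hD : ∀ n, D (e n) = wS l n • e n)
    (b : unitary (H →L[ℂ] H)) {T : H →L[ℂ] H} (hT : IsSelfAdjoint T)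
    (hbT : (b : H →L[ℂ] H) * T - T * b = (2 : ℂ) • (T * b * T)) {x₀ : H} (hx₀ : x₀ ≠ 0)
    (hTx₀ : T x₀ = wS l 0 • x₀)
    (hdense : ∀ y : H, (∀ n : ℤ, ⟪(↑(b ^ n) : H →L[ℂ] H) x₀, y⟫_ℂ = 0) → y = 0) :
    ∃ U : H ≃ₗᵢ[ℂ] H, (∀ x, U ((b : H →L[ℂ] H) x) = B₀ (U x)) ∧ ∀ x, U (T x) = D (U x) := by
  set f : ℤ → H := fun n => (↑(b ^ n) : H →L[ℂ] H) x₀ with hf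
  have hf_succ (n : ℤ) : f (n + 1) = (b : H →L[ℂ] H) (f n) := by
    simp only [hf, add_comm n, zpow_one_add]; rfl
  have hf_pred (n : ℤ) : f (n - 1) = (star (b : H →L[ℂ] H)) (f n) := by
    simp only [hf, sub_eq_neg_add, zpow_add, zpow_neg_one]; rfl
  have hTf (n : ℤ) : T (f n) = wS l n • f n := by
    induction n with
    | zero => simpa [hf] using hTx₀
    | succ n ih =>
      rw [hf_succ]
      convert! apply_eq_inv_smul hbT (add_two_mul_ne_zero hl n) ?_ ih using 2
      · simp only [wS]
        congr 1
        push_cast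
        ring
      · convert! add_two_mul_ne_zero hl (n + 1) using 1
        push_cast
        ring
    | pred n ih =>
      rw [hf_pred]
      convert! apply_eq_inv_smul (shift_star_commutator hT hbT) (add_two_mul_ne_zero hl _) ?_ ih
        using 2
      · simp only [wS]
        congr 1
        push_cast
        ring
      · convert! add_two_mul_ne_zero hl (-n - 1) using 1
        push_cast
        ring
  have hnorm (n : ℤ) : ‖f n‖ = ‖x₀‖ :=
    (norm_map_iff_adjoint_comp_self _).2 (b ^ n).2.1 x₀
  have hx₀' : ‖x₀‖ ≠ 0 := norm_ne_zero_iff.2 hx₀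
  have horth : Orthonormal ℂ fun n => ((‖x₀‖ : ℂ)⁻¹) • f n := by
    refine ⟨fun n => ?_, fun m n hmn => ?_⟩
    · rw [norm_smul, hnorm]
      simp [hx₀']
    · have h1 : ⟪f m, T (f n)⟫_ℂ = ⟪T (f m), f n⟫_ℂ := by
        rw [← adjoint_inner_left, ← star_eq_adjoint, hT.star_eq]
      rw [hTf, hTf, inner_smul_left, inner_smul_right] at h1
      have h2 : wS l n ≠ starRingEnd ℂ (wS l m) := by
        simp only [wS, map_inv₀, map_add, map_mul, Complex.conj_ofReal, Complex.conj_ofNat, map_one,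
          map_intCast]
        intro h
        have h3 := inv_injective h
        have : (n : ℂ) = m := by linear_combination h3 / 2
        exact hmn (by exact_mod_cast this.symm)
      have h3 : ⟪f m, f n⟫_ℂ = 0 := by
        by_contra h
        exact h2 (mul_right_cancel₀ h h1)
      simp only [inner_smul_left, inner_smul_right, h3, mul_zero]
  let V : HilbertBasis ℤ ℂ H := HilbertBasis.mkOfOrthogonalEqBot horth (by
    rw [Submodule.eq_bot_iff]
    intro y hy
    refine hdense y fun n => ?_
    have h := (Submodule.mem_orthogonal _ _).1 hy _ (Submodule.subset_span ⟨n, rfl⟩)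
    rw [inner_smul_left] at h
    refine (mul_eq_zero.1 h).resolve_left ?_
    simpa using hx₀)
  have hVf (n : ℤ) : V.repr (f n) = (‖x₀‖ : ℂ) • e n := by
    have h : V n = (‖x₀‖ : ℂ)⁻¹ • f n :=
      congrFun (HilbertBasis.coe_mkOfOrthogonalEqBot horth _) n
    have h' : f n = (‖x₀‖ : ℂ) • V n := by
      rw [h, smul_inv_smul₀ (by exact_mod_cast hx₀')]
    rw [h', map_smul, V.repr_self]
    rfl
  have key : ∀ {S S' : H →L[ℂ] H}, (∀ n, V.repr (S (f n)) = S' (V.repr (f n))) →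
      ∀ x, V.repr (S x) = S' (V.repr x) := by
    intro S S' h x
    have h' : ((V.repr : H →L[ℂ] H) ∘L S) ∘L (V.repr.symm : H →L[ℂ] H) = S' := by
      refine clm_ext_e fun n => ?_
      have h1 : e n = (‖x₀‖ : ℂ)⁻¹ • V.repr (f n) := by
        rw [hVf, inv_smul_smul₀ (by exact_mod_cast hx₀')]
      rw [h1]
      simp [h]
    simpa using congr($h' (V.repr x))
  exact ⟨V.repr, key fun n => by rw [← hf_succ, hVf, hVf, map_smul, hB₀],
    key fun n => by rw [hTf, map_smul, hVf, map_smul, hD, smul_comm]⟩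

theorem apply_mem_of_one_add_mul_eq {M : Submodule ℂ H} (hM : IsClosed (M : Set H))
    {w B : H →L[ℂ] H} (hw : ‖w‖ ≤ 1) {c : ℂ} (hc : ‖c‖ < 1)
    (h : (1 + c • w) * B = w + starRingEnd ℂ c • 1) (hwM : ∀ x ∈ M, w x ∈ M) {x : H}
    (hx : x ∈ M) : B x ∈ M := by
  have hn : ‖(-c) • w‖ < 1 := by
    rw [norm_smul, norm_neg]
    nlinarith [norm_nonneg c, norm_nonneg w]
  have hB : B = Ring.inverse (1 - (-c) • w) * (w + starRingEnd ℂ c • 1) := by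
    rw [← h, neg_smul, sub_neg_eq_add, ← mul_assoc, Ring.inverse_mul_cancel, one_mul]
    simpa [sub_eq_add_neg] using isUnit_one_sub_of_norm_lt_one hn
  have hy : w x + starRingEnd ℂ c • x ∈ M := M.add_mem (hwM x hx) (M.smul_mem _ hx)
  have hs := (hasSum_geom_series_inverse _ hn).map
    (ContinuousLinearMap.apply ℂ H (w x + starRingEnd ℂ c • x))
    (ContinuousLinearMap.apply ℂ H _).continuous
  rw [hB]
  refine hM.mem_of_tendsto hs.tendsto_sum_nat (.of_forall fun N => M.sum_mem fun n hn' => ?_)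
  clear hn'
  change (((-c) • w) ^ n) (w x + starRingEnd ℂ c • x) ∈ M
  induction n with
  | zero => simpa using hy
  | succ n ih =>
    rw [pow_succ']
    exact M.smul_mem _ (hwM _ ih)

theorem eq_zero_of_inner_zpow_eq_zero {B₀ : H →L[ℂ] H} (hB₀ : ∀ n : ℤ, B₀ (e n) = e (n + 1))
    (b : unitary (H →L[ℂ] H)) {c ε : ℂ} (hc : ‖c‖ < 1) (hε : ‖ε‖ = 1)
    (h : (1 + (starRingEnd ℂ c * ε) • (b : H →L[ℂ] H)) * B₀ = ε • (b : H →L[ℂ] H) + c • 1)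
    (hcomm : Commute (b : H →L[ℂ] H) B₀) {z : H}
    (hz : ∀ n : ℤ, ⟪(↑(b ^ n) : H →L[ℂ] H) (e 0), z⟫_ℂ = 0) : z = 0 := by
  let M : Submodule ℂ H := (Submodule.span ℂ (Set.range fun n : ℤ =>
    (↑(b ^ n) : H →L[ℂ] H) (e 0)))ᗮ
  have hM (x : H) : x ∈ M ↔ ∀ n : ℤ, ⟪(↑(b ^ n) : H →L[ℂ] H) (e 0), x⟫_ℂ = 0 := by
    refine ⟨fun hx n => (Submodule.mem_orthogonal _ _).1 hx _ (Submodule.subset_span ⟨n, rfl⟩),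
      fun hx => (Submodule.mem_orthogonal _ _).2 fun y hy => ?_⟩
    induction hy using Submodule.span_induction with
    | mem y hy => obtain ⟨n, rfl⟩ := hy; exact hx n
    | zero => exact inner_zero_left _
    | add y y' _ _ h h' => rw [inner_add_left, h, h', add_zero]
    | smul t y _ h => rw [inner_smul_left, h, mul_zero]
  have hMc : IsClosed (M : Set H) := Submodule.isClosed_orthogonal _
  have hbn (x : H) (n : ℤ) : (↑(b ^ (n + 1)) : H →L[ℂ] H) x = (b : H →L[ℂ] H)
      ((↑(b ^ n) : H →L[ℂ] H) x) := by
    rw [add_comm n, zpow_one_add]; rfl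
  have hbM : ∀ x ∈ M, (b : H →L[ℂ] H) x ∈ M := fun x hx => (hM _).2 fun n => by
    rw [← sub_add_cancel n 1, hbn, Unitary.inner_map_map]
    exact (hM x).1 hx _
  have hbM' : ∀ x ∈ M, star (b : H →L[ℂ] H) x ∈ M := fun x hx => (hM _).2 fun n => by
    rw [star_eq_adjoint, adjoint_inner_right, ← hbn]
    exact (hM x).1 hx _
  have hnorm : ‖(b : H →L[ℂ] H)‖ ≤ 1 :=
    ContinuousLinearMap.opNorm_le_bound _ zero_le_one fun x => by
      rw [Unitary.norm_map, one_mul]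
  have hnorm' : ‖star (b : H →L[ℂ] H)‖ = ‖(b : H →L[ℂ] H)‖ := by
    rw [star_eq_adjoint, LinearIsometryEquiv.norm_map]
  have hBM : ∀ x ∈ M, B₀ x ∈ M := fun x hx => by
    refine apply_mem_of_one_add_mul_eq (w := ε • (b : H →L[ℂ] H)) (c := starRingEnd ℂ c) hMc
      (by rwa [norm_smul, hε, one_mul]) (by rwa [RCLike.norm_conj]) ?_
      (fun x hx => M.smul_mem _ (hbM x hx)) hx
    rw [smul_smul, h, Complex.conj_conj]
  have hBM' : ∀ x ∈ M, star B₀ x ∈ M := fun x hx => by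
    refine apply_mem_of_one_add_mul_eq (w := starRingEnd ℂ ε • star (b : H →L[ℂ] H)) (c := c) hMc
      (by rwa [norm_smul, RCLike.norm_conj, hε, one_mul, hnorm']) hc ?_
      (fun x hx => M.smul_mem _ (hbM' x hx)) hx
    have h' := congr(star $h)
    have hcs : star B₀ * star (b : H →L[ℂ] H) = star (b : H →L[ℂ] H) * star B₀ := hcomm.star_star.symm
    simp only [star_mul, star_add, star_smul, star_one, mul_add, mul_one, mul_smul_comm, hcs] at h'
    simpa [add_mul, smul_smul, mul_comm c] using h'
  have hz0 {x : H} (hx : x ∈ M) : ⟪e 0, x⟫_ℂ = 0 := by simpa using (hM x).1 hx 0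
  suffices hn : ∀ n : ℤ, ∀ x ∈ M, ⟪e n, x⟫_ℂ = 0 from
    ext_inner_e fun n => by rw [hn n z ((hM z).2 hz), inner_zero_right]
  intro n
  induction n with
  | zero => exact fun x hx => hz0 hx
  | succ n ih =>
    intro x hx
    rw [← hB₀, ← adjoint_inner_right, ← star_eq_adjoint]
    exact ih _ (hBM' x hx)
  | pred n ih =>
    intro x hx
    rw [← adjoint_e hB₀, star_eq_adjoint, adjoint_inner_left]
    exact ih _ (hBM x hx)

section Block

variable {E : Type*} [NormedAddCommGroup E] [NormedSpace ℂ E]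

theorem blockOp_mul (A S A' B T B' : E →L[ℂ] E) :
    blockOp A S A' * blockOp B T B' = blockOp (A * B) (A * T + S * B') (A' * B') := by
  refine ContinuousLinearMap.ext fun x => (WithLp.ofLp_injective 2) (Prod.ext ?_ ?_) <;>
    simp [blockOp, add_assoc]

theorem blockOp_one : blockOp (1 : E →L[ℂ] E) 0 1 = 1 := by
  refine ContinuousLinearMap.ext fun x => (WithLp.ofLp_injective 2) (Prod.ext ?_ ?_) <;>
    simp [blockOp]

theorem smul_blockOp (t : ℂ) (A S A' : E →L[ℂ] E) :
    t • blockOp A S A' = blockOp (t • A) (t • S) (t • A') := by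
  refine ContinuousLinearMap.ext fun x => (WithLp.ofLp_injective 2) (Prod.ext ?_ ?_) <;>
    simp [blockOp]

theorem blockOp_sub (A S A' B T B' : E →L[ℂ] E) :
    blockOp A S A' - blockOp B T B' = blockOp (A - B) (S - T) (A' - B') := by
  refine ContinuousLinearMap.ext fun x => (WithLp.ofLp_injective 2) (Prod.ext ?_ ?_)
  · simp [blockOp]
    abel
  · simp [blockOp]

theorem blockOp_mul_inverse {K Q : E →L[ℂ] E} (h : K * Q = 1) (S : E →L[ℂ] E) :
    blockOp K S K * blockOp Q (-(Q * S * Q)) Q = 1 := by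
  rw [blockOp_mul, h, ← blockOp_one, mul_neg, ← mul_assoc, ← mul_assoc, h, one_mul, neg_add_cancel]

theorem blockOp_inverse_mul {K Q : E →L[ℂ] E} (h : Q * K = 1) (S : E →L[ℂ] E) :
    blockOp Q (-(Q * S * Q)) Q * blockOp K S K = 1 := by
  rw [blockOp_mul, h, ← blockOp_one, neg_mul, mul_assoc _ Q K, h, mul_one, add_neg_cancel]

theorem isUnit_blockOp {K : E →L[ℂ] E} (h : IsUnit K) (S : E →L[ℂ] E) :
    IsUnit (blockOp K S K) := by
  obtain ⟨k, rfl⟩ := h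
  exact ⟨⟨_, _, blockOp_mul_inverse k.mul_inv S, blockOp_inverse_mul k.inv_mul S⟩, rfl⟩

theorem spectrum_blockOp_subset (B S : E →L[ℂ] E) :
    spectrum ℂ (blockOp B S B) ⊆ spectrum ℂ B := by
  intro z hz hB
  refine hz ?_
  have h := isUnit_blockOp hB (-S)
  change IsUnit (algebraMap ℂ _ z - blockOp B S B)
  convert! h using 1
  rw [Algebra.algebraMap_eq_smul_one, Algebra.algebraMap_eq_smul_one, ← blockOp_one, smul_blockOp,
    blockOp_sub, smul_zero, zero_sub]

theorem mobius_blockOp [CompleteSpace E] (θ : ℝ) (c : ℂ) {B S Q : E →L[ℂ] E}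
    (hQ : Q * (1 - starRingEnd ℂ c • B) = 1) (hQ' : (1 - starRingEnd ℂ c • B) * Q = 1) :
    mobius θ c (blockOp B S B) =
      blockOp (Complex.exp (θ * Complex.I) • ((B - c • 1) * Q))
        ((Complex.exp (θ * Complex.I) * (1 - c * starRingEnd ℂ c)) • (Q * S * Q))
        (Complex.exp (θ * Complex.I) • ((B - c • 1) * Q)) := by
  have h1 : 1 - starRingEnd ℂ c • blockOp B S B = blockOp (1 - starRingEnd ℂ c • B)
      (-(starRingEnd ℂ c • S)) (1 - starRingEnd ℂ c • B) := by
    rw [← blockOp_one, smul_blockOp, blockOp_sub, zero_sub]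
  have h2 : blockOp B S B - c • 1 = blockOp (B - c • 1) S (B - c • 1) := by
    rw [← blockOp_one, smul_blockOp, blockOp_sub, smul_zero, sub_zero]
  rw [mobius, h1, h2, Ring.inverse_eq_of_mul_eq_one (blockOp_inverse_mul hQ _)
    (blockOp_mul_inverse hQ' _), blockOp_mul, smul_blockOp, mul_smul]
  congr 2
  have h3 : starRingEnd ℂ c • ((B - c • 1) * Q) + 1 = (1 - c * starRingEnd ℂ c) • Q := by
    conv_lhs => rw [← smul_mul_assoc]; arg 2; rw [← hQ']
    rw [← add_mul, ← smul_one_mul (1 - c * starRingEnd ℂ c) Q]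
    congr 1
    module
  rw [← smul_mul_assoc, ← smul_mul_assoc, ← h3]
  simp only [mul_neg, neg_mul, neg_neg, mul_smul_comm, smul_mul_assoc, add_mul, one_mul, mul_assoc]

/-- The direct sum `U ⊕ U` of a linear isometry equivalence with itself. -/
def prodSelfCongr {F : Type*} [NormedAddCommGroup F] [NormedSpace ℂ F] (U : E ≃ₗᵢ[ℂ] F) :
    WithLp 2 (E × E) ≃ₗᵢ[ℂ] WithLp 2 (F × F) where
  toLinearEquiv := (WithLp.linearEquiv 2 ℂ (E × E)).trans
    ((U.toLinearEquiv.prodCongr U.toLinearEquiv).trans (WithLp.linearEquiv 2 ℂ (F × F)).symm)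
  norm_map' x := by simp [WithLp.prod_norm_eq_of_L2]

theorem unitarilyEquiv_blockOp {F : Type*} [NormedAddCommGroup F] [NormedSpace ℂ F]
    {A S : E →L[ℂ] E} {B T : F →L[ℂ] F} (U : E ≃ₗᵢ[ℂ] F) (hA : ∀ x, U (A x) = B (U x))
    (hS : ∀ x, U (S x) = T (U x)) : UnitarilyEquiv (blockOp A S A) (blockOp B T B) := by
  refine ⟨prodSelfCongr U, fun x => ?_⟩
  refine (WithLp.ofLp_injective 2) (Prod.ext ?_ ?_) <;> simp [prodSelfCongr, blockOp, hA, hS]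

end Block

theorem HasFormalDeriv.conj {C A : Type*} [CommCStarAlgebra C] [CStarAlgebra A] {ρ : C →⋆ₐ[ℂ] A}
    {D : A} {f q s : C} {r : ℂ} (h : HasFormalDeriv ρ D f (r • (q * f * s))) :
    ρ f * (r • (ρ s * D * ρ q)) - r • (ρ s * D * ρ q) * ρ f =
      (2 : ℂ) • (r • (ρ s * D * ρ q) * ρ f * (r • (ρ s * D * ρ q))) := by
  have hs : ρ f * ρ s = ρ s * ρ f := by rw [← map_mul, mul_comm, map_mul]
  have hq : ρ q * ρ f = ρ f * ρ q := by rw [← map_mul, mul_comm, map_mul]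
  have h1 : ρ f * (r • (ρ s * D * ρ q)) - r • (ρ s * D * ρ q) * ρ f =
      r • (ρ s * (ρ f * D - D * ρ f) * ρ q) := by
    rw [mul_smul_comm, smul_mul_assoc, ← smul_sub, mul_sub, sub_mul]
    simp only [← mul_assoc, hs]
    simp only [mul_assoc, hq]
  rw [h1, h]
  simp only [map_smul, map_mul, mul_smul_comm, smul_mul_assoc, mul_assoc]
  rw [smul_comm r (2 : ℂ)]

theorem HasFormalDeriv.apply_eigenvector {C E : Type*} [CommCStarAlgebra C]
    [NormedAddCommGroup E] [InnerProductSpace ℂ E] [CompleteSpace E] {ρ : C →⋆ₐ[ℂ] (E →L[ℂ] E)}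
    {D : E →L[ℂ] E} {k g qs q : C} {p r : ℂ} (hp : p ≠ 0) (hqs : qs * k = 1)
    (h : HasFormalDeriv ρ D (k * g) (p • ((r • q - k) * g))) {x : E}
    (hx : D x = (2 * p)⁻¹ • x) :
    (r • (ρ qs * D * ρ q)) (ρ g x) = (2 * p)⁻¹ • ρ g x := by
  have h1 := congr($h x)
  simp only [map_smul, sub_mul, map_sub, smul_mul_assoc, _root_.sub_apply, mul_apply_eq_comp,
    _root_.smul_apply, hx, smul_sub, smul_smul] at h1
  rw [show 2 * ((2 * p)⁻¹ * p) = 1 by field_simp, one_smul,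
    show 2 * ((2 * p)⁻¹ * (p * r)) = r by field_simp] at h1
  have h2 : r • D (ρ (q * g) x) = (2 * p)⁻¹ • ρ (k * g) x := (sub_left_injective h1).symm
  have h3 : qs * (k * g) = g := by rw [← mul_assoc, hqs, one_mul]
  calc (r • (ρ qs * D * ρ q)) (ρ g x) = ρ qs (r • D (ρ (q * g) x)) := by simp
    _ = (2 * p)⁻¹ • (ρ (qs * (k * g))) x := by rw [h2]; simp
    _ = _ := by rw [h3]

section Moebius

variable {C : Type*} [CommCStarAlgebra C] {u q : C} {c ε : ℂ}

theorem sub_smul_one_eq (hu : u ∈ unitary C) : u - c • 1 = u * (1 - c • star u) := by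
  rw [mul_sub, mul_smul_comm, Unitary.mul_star_self_of_mem hu, mul_one]

theorem star_mul_one_sub (hq : q * (1 - starRingEnd ℂ c • u) = 1) :
    star q * (1 - c • star u) = 1 := by
  simpa [mul_comm] using congr(star $hq)

theorem moebius_mem_unitary (hu : u ∈ unitary C) (hε : ‖ε‖ = 1)
    (hq : q * (1 - starRingEnd ℂ c • u) = 1) : ε • ((u - c • 1) * q) ∈ unitary C := by
  have hε' : starRingEnd ℂ ε * ε = 1 := by rw [Complex.conj_mul', hε]; simp
  have h : star (ε • ((u - c • 1) * q)) * (ε • ((u - c • 1) * q)) = 1 := by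
    rw [sub_smul_one_eq hu]
    simp only [star_smul, star_mul, star_sub, star_one, star_star, smul_mul_smul_comm,
      RCLike.star_def, hε', one_smul]
    calc _ = (star u * u) * (star q * (1 - c • star u)) * (q * (1 - starRingEnd ℂ c • u)) := by ring
      _ = 1 := by rw [star_mul_one_sub hq, hq, Unitary.star_mul_self_of_mem hu]; simp
  exact Unitary.mem_iff.2 ⟨h, (mul_comm _ _).trans h⟩

theorem norm_le_one_of_mem_unitary (hu : u ∈ unitary C) : ‖u‖ ≤ 1 := by
  have h : ‖u‖ * ‖u‖ = ‖(1 : C)‖ := by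
    rw [← CStarRing.norm_star_mul_self, Unitary.star_mul_self_of_mem hu]
  have h1 : ‖(1 : C)‖ * ‖(1 : C)‖ = ‖(1 : C)‖ := by
    rw [← CStarRing.norm_star_mul_self, star_one, one_mul]
  have h2 : ‖(1 : C)‖ ≤ 1 := by nlinarith [norm_nonneg (1 : C)]
  nlinarith [norm_nonneg u]

theorem exists_moebius_intertwiner {l : ℝ} (hl : -1 < l ∧ l < 1) (ρ : C →⋆ₐ[ℂ] (H →L[ℂ] H))
    {D : H →L[ℂ] H} (hB₀ : ∀ n : ℤ, ρ u (e n) = e (n + 1)) (hD : ∀ n, D (e n) = wS l n • e n)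
    (hu : u ∈ unitary C) (hc : ‖c‖ < 1) (hε : ‖ε‖ = 1)
    (hq : q * (1 - starRingEnd ℂ c • u) = 1) :
    ∃ U : H ≃ₗᵢ[ℂ] H, (∀ x, U (ρ (ε • ((u - c • 1) * q)) x) = ρ u (U x)) ∧
      ∀ x, U (((1 - c * starRingEnd ℂ c) • (ρ (star q) * D * ρ q)) x) = D (U x) := by
  have hqs := star_mul_one_sub hq
  have hDs := isSelfAdjoint_of_diagonal hD
  have hud : HasFormalDeriv ρ D u u := shift_commutator_diagonal hl hB₀ hD
  have hvd : HasFormalDeriv ρ D (star u) (-star u) := by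
    have h := shift_star_commutator hDs hud
    simpa [HasFormalDeriv, map_star] using h
  have hu1 := norm_le_one_of_mem_unitary hu
  have hf := moebius_mem_unitary hu hε hq
  obtain ⟨g, hg, hgd⟩ := HasFormalDeriv.exists_eigenfunction hu1 (by rwa [norm_star])
    (Unitary.mul_star_self_of_mem hu) hud hvd hc hq hqs (((l : ℂ) + 1) / 2)
  have hp : ((l : ℂ) + 1) / 2 ≠ 0 := by
    simpa using add_two_mul_ne_zero hl 0
  have hw : wS l 0 = (2 * (((l : ℂ) + 1) / 2))⁻¹ := by
    simp [wS, mul_div_cancel₀]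
  have hg' : IsUnit (ρ g) := hg.map ρ
  let b : unitary (H →L[ℂ] H) := ⟨ρ (ε • ((u - c • 1) * q)), Unitary.map_mem ρ hf⟩
  have hbρ (a : C) (n : ℤ) : Commute (↑(b ^ n) : H →L[ℂ] H) (ρ a) := by
    have h : Commute (Unitary.toUnits b : H →L[ℂ] H) (ρ a) := (Commute.all _ a).map ρ
    simpa only [← map_zpow] using! h.units_zpow_left n
  refine exists_intertwiner hl hB₀ hD b (x₀ := ρ g (e 0)) ?_ ?_ ?_ ?_ ?_
  · rw [isSelfAdjoint_iff]
    simp [hDs.star_eq, map_star, mul_assoc, mul_comm c]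
  · refine HasFormalDeriv.conj ?_
    convert! (HasFormalDeriv.moebius hu1 hud hc hq).smul ε using 1
    rw [smul_comm ε, sub_smul_one_eq hu]
    congr 1
    simp only [mul_smul_comm, smul_mul_assoc]
    congr 1
    calc _ = u * q ^ 2 * (star q * (1 - c • star u)) := by ring
      _ = _ := by rw [hqs, mul_one]
  · intro h
    have h0 : e 0 = 0 := by
      obtain ⟨G, hG⟩ := hg'
      rw [← hG] at h
      simpa [← mul_apply_eq_comp] using congr((↑G⁻¹ : H →L[ℂ] H) $h)
    have h1 := inner_e_e 0 0
    rw [h0] at h1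
    simp at h1
  · rw [hw]
    exact HasFormalDeriv.apply_eigenvector hp hqs hgd (by rw [hD, hw])
  · intro y hy
    have hz : star (ρ g) y = 0 := by
      refine eq_zero_of_inner_zpow_eq_zero hB₀ b (ε := starRingEnd ℂ ε) hc
        (by rwa [RCLike.norm_conj]) ?_ (by simpa using hbρ u 1) fun n => ?_
      · have hε' : starRingEnd ℂ ε * ε = 1 := by rw [Complex.conj_mul', hε]; simp
        change (1 + (starRingEnd ℂ c * starRingEnd ℂ ε) • ρ (ε • ((u - c • 1) * q))) * ρ u =
          starRingEnd ℂ ε • ρ (ε • ((u - c • 1) * q)) + c • 1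
        rw [mul_smul, ← map_smul ρ, smul_smul, hε', one_smul, ← map_smul ρ, ← map_one ρ,
          ← map_add, ← map_mul, ← map_smul ρ, ← map_add]
        congr 1
        have h : u - c • 1 = (u - c • 1) * q * (1 - starRingEnd ℂ c • u) := by
          rw [mul_assoc, hq, mul_one]
        rw [mul_sub, mul_one, eq_sub_iff_add_eq, mul_smul_comm, ← smul_mul_assoc] at h
        rw [add_mul, one_mul, ← sub_eq_iff_eq_add, add_sub_right_comm, h]
      · rw [star_eq_adjoint, adjoint_inner_right, ← mul_apply_eq_comp, ← (hbρ g n).eq]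
        exact hy n
    obtain ⟨G, hG⟩ := hg'.star
    rw [← hG] at hz
    simpa [← mul_apply_eq_comp] using congr((↑G⁻¹ : H →L[ℂ] H) $hz)

theorem isUnit_and_unitarilyEquiv_mobius {l : ℝ} (hl : -1 < l ∧ l < 1)
    (ρ : C →⋆ₐ[ℂ] (H →L[ℂ] H)) {B₀ Sl : H →L[ℂ] H} (hρ : ρ u = B₀)
    (hB₀ : ∀ n : ℤ, B₀ (e n) = e (n + 1)) (hSl : ∀ n : ℤ, Sl (e n) = wS l n • e (n + 1))
    (hu : u ∈ unitary C) (hc : ‖c‖ < 1) (θ : ℝ) (α : ℂ) :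
    IsUnit (1 - starRingEnd ℂ c • blockOp B₀ (α • Sl) B₀) ∧
      UnitarilyEquiv (mobius θ c (blockOp B₀ (α • Sl) B₀)) (blockOp B₀ (α • Sl) B₀) := by
  subst hρ
  obtain ⟨k, hk⟩ : IsUnit (1 - starRingEnd ℂ c • u) := isUnit_one_sub_of_norm_lt_one <| by
    rw [norm_smul, RCLike.norm_conj]
    nlinarith [norm_nonneg c, norm_nonneg u, norm_le_one_of_mem_unitary hu]
  obtain ⟨q, hq⟩ : ∃ q, q * (1 - starRingEnd ℂ c • u) = 1 := ⟨↑k⁻¹, by rw [← hk, k.inv_mul]⟩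
  have hQ : ρ q * (1 - starRingEnd ℂ c • ρ u) = 1 := by
    rw [← map_smul ρ, ← map_one ρ, ← map_sub, ← map_mul, hq]
  have hQ' : (1 - starRingEnd ℂ c • ρ u) * ρ q = 1 := by
    rw [← map_smul ρ, ← map_one ρ, ← map_sub, ← map_mul, mul_comm, hq]
  have hu' : ρ u * star (ρ u) = 1 := by
    rw [← map_star, ← map_mul, Unitary.mul_star_self_of_mem hu, map_one]
  generalize hε : Complex.exp (θ * Complex.I) = ε
  have hε1 : ‖ε‖ = 1 := hε ▸ Complex.norm_exp_ofReal_mul_I θ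
  obtain ⟨U, hU, hUT⟩ := exists_moebius_intertwiner hl ρ (D := star (ρ u) * Sl) hB₀
    (star_mul_weightedShift_e hB₀ hSl) hu hc hε1 hq
  constructor
  · rw [← blockOp_one, smul_blockOp, blockOp_sub]
    exact isUnit_blockOp ⟨⟨_, _, hQ', hQ⟩, rfl⟩ _
  have hf : (ε • ((u - c • 1) * q)) * star q = ε • (q * u) := by
    rw [sub_smul_one_eq hu, smul_mul_assoc]
    congr 1
    calc _ = q * u * (star q * (1 - c • star u)) := by ring
      _ = _ := by rw [star_mul_one_sub hq, mul_one]
  have hρf : ε • ((ρ u - c • 1) * ρ q) = ρ (ε • ((u - c • 1) * q)) := by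
    simp
  have hS : ρ u * (star (ρ u) * Sl) = Sl := by rw [← mul_assoc, hu', one_mul]
  have key : (ε * (1 - c * starRingEnd ℂ c)) • (ρ q * (α • Sl) * ρ q) =
      α • (ρ (ε • ((u - c • 1) * q)) *
        ((1 - c * starRingEnd ℂ c) • (ρ (star q) * (star (ρ u) * Sl) * ρ q))) := by
    rw [mul_smul_comm, mul_smul_comm (1 - c * starRingEnd ℂ c), ← mul_assoc _ _ (ρ q), ← mul_assoc _ (ρ (star q)), ← map_mul, hf, map_smul,
      map_mul, smul_mul_assoc ε, mul_assoc (ρ q) (ρ u), hS]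
    simp only [smul_mul_assoc, smul_smul]
    congr 1
    ring
  rw [mobius_blockOp θ c hQ hQ', hε, hρf, key]
  refine unitarilyEquiv_blockOp U hU fun x => ?_
  rw [_root_.smul_apply, map_smul, mul_apply_eq_comp, hU, hUT, ← mul_apply_eq_comp, hS,
    _root_.smul_apply]

end Moebius

theorem exists_commCStarAlgebra_of_mem_unitary.{v} {A : Type v} [CStarAlgebra A] {a : A}
    (ha : a ∈ unitary A) : ∃ (C : Type v) (_ : CommCStarAlgebra C) (ρ : C →⋆ₐ[ℂ] A) (u : C),
      u ∈ unitary C ∧ ρ u = a := by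
  have : IsStarNormal a := ⟨ha.1.trans ha.2.symm⟩
  exact ⟨StarAlgebra.elemental ℂ a, inferInstance, (StarAlgebra.elemental ℂ a).subtype,
    ⟨a, StarAlgebra.elemental.self_mem ℂ a⟩,
    Unitary.mem_iff.2 ⟨Subtype.ext ha.1, Subtype.ext ha.2⟩, rfl⟩

/-- the operator `B(λ, α)` is homogeneous. -/
theorem stmt11 (l : ℝ) (hl : -1 < l ∧ l < 1) (α : ℂ)
    (B₀ Sl : H →L[ℂ] H)
    (hB₀ : ∀ n : ℤ, B₀ (e n) = e (n + 1))
    (hSl : ∀ n : ℤ, Sl (e n) = wS l n • e (n + 1)) :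
    Homogeneous (blockOp B₀ (α • Sl) B₀) := by
  have hBu := mem_unitary_of_shift hB₀
  obtain ⟨C, _, ρ, u, hu, hρ⟩ := exists_commCStarAlgebra_of_mem_unitary hBu
  exact ⟨fun z hz => Metric.sphere_subset_closedBall
    (spectrum.subset_circle_of_unitary hBu (spectrum_blockOp_subset _ _ hz)),
    fun θ c hc => isUnit_and_unitarilyEquiv_mobius hl ρ hρ hB₀ hSl hu hc θ α⟩
end
end

section
/- For every λ ∈ (−1, 1], every real a ≠ 0, and every α > 0, the operators B(λ, ia, α) and B(λ, −ia, α) on ℓ²(ℤ,ℂ) ⊕ ℓ²(ℤ,ℂ) are unitarily equivalent. -/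
noncomputable section

open ContinuousLinearMap

/-- A unitary `D` on `E` followed by the orthogonal reflection `[[-c, t], [t, c]]`, acting on the
Hilbert space direct sum `E ⊕ E`. -/
def reflectionProd {E : Type*} [NormedAddCommGroup E] [InnerProductSpace ℂ E]
    (D : E ≃ₗᵢ[ℂ] E) (c t : ℝ) (h : c ^ 2 + t ^ 2 = 1) :
    WithLp 2 (E × E) ≃ₗᵢ[ℂ] WithLp 2 (E × E) where
  toFun z := WithLp.toLp 2
    (-(c : ℂ) • D z.fst + (t : ℂ) • D z.snd, (t : ℂ) • D z.fst + (c : ℂ) • D z.snd)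
  invFun z := WithLp.toLp 2
    (-(c : ℂ) • D.symm z.fst + (t : ℂ) • D.symm z.snd,
      (t : ℂ) • D.symm z.fst + (c : ℂ) • D.symm z.snd)
  map_add' z w := by
    refine WithLp.ofLp_injective 2 (Prod.ext ?_ ?_)
    all_goals simp only [WithLp.add_fst, WithLp.add_snd, WithLp.ofLp_add, Prod.fst_add,
      Prod.snd_add, map_add]; module
  map_smul' k z := by
    refine WithLp.ofLp_injective 2 (Prod.ext ?_ ?_)
    all_goals simp only [WithLp.smul_fst, WithLp.smul_snd, WithLp.ofLp_smul, Prod.smul_fst,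
      Prod.smul_snd, map_smul, RingHom.id_apply]; module
  left_inv z := by
    have h' : (c : ℂ) ^ 2 + (t : ℂ) ^ 2 = 1 := mod_cast h
    refine WithLp.ofLp_injective 2 (Prod.ext ?_ ?_)
    all_goals
      simp only [WithLp.fst, WithLp.snd, map_add, map_smul,
        LinearIsometryEquiv.symm_apply_apply]
      match_scalars
      all_goals first | ring1 | linear_combination h'
  right_inv z := by
    have h' : (c : ℂ) ^ 2 + (t : ℂ) ^ 2 = 1 := mod_cast h
    refine WithLp.ofLp_injective 2 (Prod.ext ?_ ?_)
    all_goals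
      simp only [WithLp.fst, WithLp.snd, map_add, map_smul,
        LinearIsometryEquiv.apply_symm_apply]
      match_scalars
      all_goals first | ring1 | linear_combination h'
  norm_map' z := by
    rw [← sq_eq_sq₀ (norm_nonneg _) (norm_nonneg _), WithLp.prod_norm_sq_eq_of_L2,
      WithLp.prod_norm_sq_eq_of_L2, ← D.norm_map z.fst, ← D.norm_map z.snd]
    change ‖-(c : ℂ) • D z.fst + (t : ℂ) • D z.snd‖ ^ 2 +
      ‖(t : ℂ) • D z.fst + (c : ℂ) • D z.snd‖ ^ 2 = _
    rw [@norm_add_sq ℂ, @norm_add_sq ℂ, neg_smul, inner_neg_left]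
    simp only [inner_smul_left, inner_smul_right, norm_smul, norm_neg, Complex.conj_ofReal,
      Complex.norm_real, mul_pow, Real.norm_eq_abs, sq_abs, map_neg, RCLike.re_eq_complex_re,
      Complex.re_ofReal_mul]
    linear_combination (‖D z.fst‖ ^ 2 + ‖D z.snd‖ ^ 2) * h

/-- If a unitary `D` intertwines `B₁` with `B₀` and `B₀` with `B₂`, then the block operators
`[[B₁, α (B₁ - B₀)], [0, B₀]]` and `[[B₂, α (B₂ - B₀)], [0, B₀]]` are unitarily equivalent. -/
theorem unitarilyEquiv_blockOp_s13 {E : Type*} [NormedAddCommGroup E] [InnerProductSpace ℂ E]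
    (D : E ≃ₗᵢ[ℂ] E) (B₀ B₁ B₂ : E →L[ℂ] E) (α : ℝ)
    (h₁ : ∀ x, D (B₁ x) = B₀ (D x)) (h₀ : ∀ x, D (B₀ x) = B₂ (D x)) :
    UnitarilyEquiv (blockOp B₁ ((α : ℂ) • (B₁ - B₀)) B₀)
      (blockOp B₂ ((α : ℂ) • (B₂ - B₀)) B₀) := by
  have hr : 0 < 1 + α ^ 2 := by positivity
  obtain ⟨t, ht⟩ : ∃ t : ℝ, t ^ 2 * (1 + α ^ 2) = 1 :=
    ⟨(√(1 + α ^ 2))⁻¹, by rw [inv_pow, Real.sq_sqrt hr.le, inv_mul_cancel₀ hr.ne']⟩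
  refine ⟨reflectionProd D (α * t) t (by linear_combination ht), fun z => ?_⟩
  refine WithLp.ofLp_injective 2 (Prod.ext ?_ ?_)
  · change -((α * t : ℝ) : ℂ) • D (B₁ z.fst + (α : ℂ) • (B₁ z.snd - B₀ z.snd)) +
        (t : ℂ) • D (B₀ z.snd) =
      B₂ (-((α * t : ℝ) : ℂ) • D z.fst + (t : ℂ) • D z.snd) +
        (α : ℂ) • (B₂ ((t : ℂ) • D z.fst + ((α * t : ℝ) : ℂ) • D z.snd) -
          B₀ ((t : ℂ) • D z.fst + ((α * t : ℝ) : ℂ) • D z.snd))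
    simp only [map_add, map_sub, map_smul, h₁, h₀, Complex.ofReal_mul]
    module
  · change (t : ℂ) • D (B₁ z.fst + (α : ℂ) • (B₁ z.snd - B₀ z.snd)) +
        ((α * t : ℝ) : ℂ) • D (B₀ z.snd) =
      B₀ ((t : ℂ) • D z.fst + ((α * t : ℝ) : ℂ) • D z.snd)
    simp only [map_add, map_sub, map_smul, h₁, h₀, Complex.ofReal_mul]
    module

/-- The diagonal unitary on `ℓ²(ℤ, ℂ)` with entries `W n` on the unit circle. -/
def diagonalUnitary (W : ℤ → Circle) : H ≃ₗᵢ[ℂ] H where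
  toFun x := ⟨fun n => W n * x n, (lp.memℓp x).mono' fun n => by simp [Circle.norm_coe]⟩
  invFun x := ⟨fun n => (W n)⁻¹ * x n, (lp.memℓp x).mono' fun n => by simp [Circle.norm_coe]⟩
  map_add' x y := by ext n; exact mul_add _ _ _
  map_smul' k x := by ext n; exact mul_left_comm _ _ _
  left_inv x := by ext n; simp
  right_inv x := by ext n; simp
  norm_map' x := by
    rw [lp.norm_eq_tsum_rpow (by simp), lp.norm_eq_tsum_rpow (by simp)]
    simp [Circle.norm_coe]

theorem diagonalUnitary_e (W : ℤ → Circle) (n : ℤ) :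
    diagonalUnitary W (e n) = (W n : ℂ) • e n := by
  ext m
  change (W m : ℂ) * e n m = (W n : ℂ) * e n m
  rcases eq_or_ne m n with rfl | h
  · rfl
  · simp [e, h]

theorem ext_e {S T : H →L[ℂ] H} (h : ∀ n, S (e n) = T (e n)) : S = T := by
  refine lp.ext_continuousLinearMap ENNReal.ofNat_ne_top fun n => ?_
  ext1
  exact h n

/-- A first order recurrence with values in a group has a solution on `ℤ`. -/
theorem exists_int_recurrence {G : Type*} [Group G] (g : ℤ → G) :
    ∃ f : ℤ → G, ∀ n, f (n + 1) = g n * f n := by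
  let f : ℤ → G := fun n => Int.rec (motive := fun _ => G)
    (fun k => Nat.rec 1 (fun j x => g j * x) k)
    (fun k => Nat.rec (g (-1))⁻¹ (fun j x => (g (Int.negSucc (j + 1)))⁻¹ * x) k) n
  refine ⟨f, fun n => ?_⟩
  rcases n with k | k
  · rfl
  · rcases k with _ | k
    · exact (mul_inv_cancel _).symm
    · exact (mul_inv_cancel_left _ _).symm

theorem norm_wB (l a : ℝ) (ha : a ≠ 0) (n : ℤ) : ‖wB l a n‖ = 1 := by
  have hne : (n : ℂ) + (1 + (l : ℂ)) / 2 - Complex.I * (a : ℂ) ≠ 0 := fun h => ha <| by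
    simpa using congrArg Complex.im h
  have hconj : (n : ℂ) + (1 + (l : ℂ)) / 2 + Complex.I * (a : ℂ) =
      starRingEnd ℂ ((n : ℂ) + (1 + (l : ℂ)) / 2 - Complex.I * (a : ℂ)) := by
    simp [map_ofNat]
  rw [wB, norm_div, hconj, RCLike.norm_conj, div_self (norm_ne_zero_iff.2 hne)]

theorem wB_neg (l a : ℝ) (n : ℤ) : wB l (-a) n = (wB l a n)⁻¹ := by
  simp only [wB, Complex.ofReal_neg, mul_neg, sub_neg_eq_add, inv_div, ← sub_eq_add_neg]

/-- `B(λ, ia, α)` and `B(λ, -ia, α)` are unitarily equivalent. -/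
theorem stmt13 (l a α : ℝ) (hl : -1 < l ∧ l ≤ 1) (ha : a ≠ 0) (hα : 0 < α)
    (B₀ B₁ B₂ : H →L[ℂ] H)
    (hB₀ : ∀ n : ℤ, B₀ (e n) = e (n + 1))
    (hB₁ : ∀ n : ℤ, B₁ (e n) = wB l a n • e (n + 1))
    (hB₂ : ∀ n : ℤ, B₂ (e n) = wB l (-a) n • e (n + 1)) :
    UnitarilyEquiv (blockOp B₁ ((α : ℂ) • (B₁ - B₀)) B₀)
      (blockOp B₂ ((α : ℂ) • (B₂ - B₀)) B₀) := by
  let c (n : ℤ) : Circle := ⟨wB l a n, mem_sphere_zero_iff_norm.2 (norm_wB l a ha n)⟩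
  obtain ⟨W, hW⟩ := exists_int_recurrence fun n => (c n)⁻¹
  have hW' (n : ℤ) : (W (n + 1) : ℂ) = (wB l a n)⁻¹ * W n := by
    rw [hW, Circle.coe_mul, Circle.coe_inv]
  have hw (n : ℤ) : wB l a n ≠ 0 := norm_ne_zero_iff.1 (by simp [norm_wB l a ha n])
  let D := diagonalUnitary W
  have hD (n : ℤ) : D (e n) = (W n : ℂ) • e n := diagonalUnitary_e W n
  have h₁ : (D : H →L[ℂ] H) ∘L B₁ = B₀ ∘L (D : H →L[ℂ] H) := ext_e fun n => by
    change D (B₁ (e n)) = B₀ (D (e n))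
    rw [hB₁, hD, map_smul, map_smul, hB₀, hD, hW', smul_smul, mul_inv_cancel_left₀ (hw n)]
  have h₀ : (D : H →L[ℂ] H) ∘L B₀ = B₂ ∘L (D : H →L[ℂ] H) := ext_e fun n => by
    change D (B₀ (e n)) = B₂ (D (e n))
    rw [hB₀, hD, hD, map_smul, hB₂, hW', wB_neg, smul_smul, mul_comm]
  exact unitarilyEquiv_blockOp_s13 D B₀ B₁ B₂ α (fun x => DFunLike.congr_fun h₁ x)
    fun x => DFunLike.congr_fun h₀ x
end
end
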